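/- arXiv:2303.11924 — 3 statements merged into one kernel-verified Lean document; each statement's English description precedes it below -/
import Mathlib

section
/- Let d ≥ 2 and let a_p, 2 ≤ p ≤ d, be real numbers, not all zero, and set ξ(t) = Σ_{p=2}^d a_p² t^p and λ(r) = 1 − (ξ(1)/ξ'(1))·ξ'(r)²(1−r²)/(ξ(1)² − ξ(r)²). Then for every ε ∈ (0,1), ∫_{−1+ε}^{1} λ(r)/(1−r²) dr ≤ (10/ε)·log d. -/
noncomputable section

/-- `ξ(t) = ∑_{p=2}^d a_p² t^p`. -/
def xi (d : ℕ) (a : ℕ → ℝ) (t : ℝ) : ℝ := ∑ p ∈ Finset.Icc 2 d, a p ^ 2 * t ^ p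

/-- `ξ'`, the derivative of `ξ`. -/
def xi' (d : ℕ) (a : ℕ → ℝ) : ℝ → ℝ := deriv (xi d a)
/-- `λ(r) = 1 − (ξ(1)/ξ'(1)) ξ'(r)² (1−r²)/(ξ(1)² − ξ(r)²)` (Eq. (3.7)). -/
def lam (d : ℕ) (a : ℕ → ℝ) (r : ℝ) : ℝ :=
  1 - xi d a 1 / xi' d a 1 * (xi' d a r ^ 2 * (1 - r ^ 2) / (xi d a 1 ^ 2 - xi d a r ^ 2))

theorem xi'_eq (d : ℕ) (a : ℕ → ℝ) (t : ℝ) :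
    xi' d a t = ∑ p ∈ Finset.Icc 2 d, a p ^ 2 * ((p : ℝ) * t ^ (p - 1)) := by
  unfold xi'
  have h : HasDerivAt (xi d a) (∑ p ∈ Finset.Icc 2 d, a p ^ 2 * ((p : ℝ) * t ^ (p - 1))) t := by
    unfold xi
    apply HasDerivAt.fun_sum
    intro p _
    exact (hasDerivAt_pow p t).const_mul _
  exact h.deriv

theorem xi_one_pos (d : ℕ) (a : ℕ → ℝ) (ha : ∃ p ∈ Finset.Icc 2 d, a p ≠ 0) : 0 < xi d a 1 := by
  obtain ⟨p, hp, h⟩ := ha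
  unfold xi
  apply Finset.sum_pos' (fun i _ => by positivity)
  exact ⟨p, hp, by positivity⟩

theorem xi_one_le (d : ℕ) (a : ℕ → ℝ) : xi d a 1 ≤ xi' d a 1 := by
  rw [xi'_eq]
  unfold xi
  apply Finset.sum_le_sum
  intro p hp
  have h2 : (2 : ℝ) ≤ p := by exact_mod_cast (Finset.mem_Icc.1 hp).1
  have := sq_nonneg (a p)
  simp only [one_pow]
  nlinarith

theorem xi_abs_le (d : ℕ) (a : ℕ → ℝ) (r : ℝ) (hr : |r| ≤ 1) : |xi d a r| ≤ xi d a 1 := by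
  unfold xi
  refine (Finset.abs_sum_le_sum_abs _ _).trans ?_
  apply Finset.sum_le_sum
  intro p hp
  rw [abs_mul, abs_pow r, abs_of_nonneg (sq_nonneg (a p)), one_pow]
  exact mul_le_mul_of_nonneg_left (pow_le_one₀ (abs_nonneg r) hr) (sq_nonneg _)

theorem lam_le_one (d : ℕ) (a : ℕ → ℝ) (ha : ∃ p ∈ Finset.Icc 2 d, a p ≠ 0)
    (r : ℝ) (hr : |r| ≤ 1) : lam d a r ≤ 1 := by
  unfold lam
  have h1 := xi_one_pos d a ha
  have h2 := xi_one_le d a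
  have h3 := xi_abs_le d a r hr
  have h4 : 0 ≤ xi d a 1 ^ 2 - xi d a r ^ 2 := by
    have := sq_le_sq' (abs_le.1 h3).1 (abs_le.1 h3).2
    linarith
  have h5 : 0 ≤ 1 - r ^ 2 := by
    have := sq_le_sq' (abs_le.1 hr).1 (abs_le.1 hr).2
    linarith
  have h6 : 0 ≤ xi' d a 1 := by linarith
  have : 0 ≤ xi d a 1 / xi' d a 1 *
      (xi' d a r ^ 2 * (1 - r ^ 2) / (xi d a 1 ^ 2 - xi d a r ^ 2)) := by positivity
  linarith

theorem lam_le_near (d : ℕ) (a : ℕ → ℝ) (ha : ∃ p ∈ Finset.Icc 2 d, a p ≠ 0)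
    (r : ℝ) (hr0 : 0 ≤ r) (hr1 : r < 1) (hr : d * (1 - r) ≤ 1) :
    lam d a r ≤ 2 * d * (1 - r) := by
  have h1 := xi_one_pos d a ha
  have h2 := xi_one_le d a
  have hx0 : 0 ≤ xi d a r := by
    unfold xi
    exact Finset.sum_nonneg fun p _ => by positivity
  have hx1 : xi d a r ≤ xi d a 1 * r := by
    unfold xi
    rw [Finset.sum_mul]
    apply Finset.sum_le_sum
    intro p hp
    rw [one_pow, mul_one]
    apply mul_le_mul_of_nonneg_left _ (sq_nonneg _)
    have := (Finset.mem_Icc.1 hp).1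
    exact pow_le_of_le_one hr0 hr1.le (by omega)
  have bern : ∀ n : ℕ, 1 - n * (1 - r) ≤ r ^ n := by
    intro n
    have := one_add_mul_le_pow (a := r - 1) (by linarith) n
    have e : 1 + (r - 1) = r := by ring
    rw [e] at this
    linarith
  have hx2 : xi d a 1 - xi d a r ≤ xi' d a 1 * (1 - r) := by
    rw [xi'_eq]
    unfold xi
    rw [Finset.sum_mul, ← Finset.sum_sub_distrib]
    apply Finset.sum_le_sum
    intro p hp
    have := mul_le_mul_of_nonneg_left (bern p) (sq_nonneg (a p))
    simp only [one_pow]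
    linarith
  have hx3 : xi' d a 1 * (1 - d * (1 - r)) ≤ xi' d a r := by
    rw [xi'_eq, xi'_eq]
    rw [Finset.sum_mul]
    apply Finset.sum_le_sum
    intro p hp
    have hb := bern (p - 1)
    have hpd : ((p - 1 : ℕ) : ℝ) ≤ d := by
      have := (Finset.mem_Icc.1 hp).2
      exact_mod_cast (by omega : p - 1 ≤ d)
    have hb' : 1 - d * (1 - r) ≤ r ^ (p - 1) := by nlinarith
    have := mul_le_mul_of_nonneg_left hb' (by positivity : 0 ≤ a p ^ 2 * (p : ℝ))
    simp only [one_pow]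
    linarith
  unfold lam
  set A := xi d a 1
  set B := xi' d a 1
  set x := xi d a r
  set y := xi' d a r
  have hB : 0 < B := by linarith
  have hA : 0 < A - x := by nlinarith
  have hden : 0 < A ^ 2 - x ^ 2 := by nlinarith
  have hden2 : A ^ 2 - x ^ 2 ≤ B * (1 - r) * (A * (1 + r)) := by
    have : (A - x) * (A + x) ≤ (B * (1 - r)) * (A * (1 + r)) := by
      apply mul_le_mul hx2 (by linarith) (by linarith)
      exact mul_nonneg hB.le (by linarith)
    linarith
  have hy : (B * (1 - d * (1 - r))) ^ 2 ≤ y ^ 2 := by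
    apply pow_le_pow_left₀ _ hx3
    exact mul_nonneg hB.le (by linarith)
  have key : (1 - d * (1 - r)) ^ 2 ≤ A / B * (y ^ 2 * (1 - r ^ 2) / (A ^ 2 - x ^ 2)) := by
    rw [div_mul_div_comm, le_div_iff₀ (by positivity)]
    have s1 : (1 - d * (1 - r)) ^ 2 * (B * (A ^ 2 - x ^ 2)) ≤
        (1 - d * (1 - r)) ^ 2 * (B * (B * (1 - r) * (A * (1 + r)))) := by gcongr
    have h5 : 0 ≤ A * (1 - r ^ 2) := mul_nonneg h1.le (by nlinarith)
    have s2 := mul_le_mul_of_nonneg_right hy h5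
    nlinarith
  nlinarith [sq_nonneg (d * (1 - r))]

theorem point_bound (d : ℕ) (hd : 2 ≤ d) (a : ℕ → ℝ)
    (ha : ∃ p ∈ Finset.Icc 2 d, a p ≠ 0)
    (ε : ℝ) (hε : ε ∈ Set.Ioo (0 : ℝ) 1) (r : ℝ) (hr : r ∈ Set.Ioo (-1 + ε) 1) :
    lam d a r / (1 - r ^ 2) ≤ 1 / ε + 2 / (1 - r + 1 / (2 * d)) := by
  obtain ⟨e0, e1⟩ := hε
  obtain ⟨r0, r1⟩ := hr
  have hd' : (2 : ℝ) ≤ d := by exact_mod_cast hd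
  have habs : |r| ≤ 1 := abs_le.2 ⟨by linarith, r1.le⟩
  have hl := lam_le_one d a ha r habs
  have hpos : 0 < 1 - r ^ 2 := by nlinarith
  have hδ : 0 < 1 - r := by linarith
  have hc : (0 : ℝ) < 1 / (2 * d) := by positivity
  have hg : 0 ≤ 2 / (1 - r + 1 / (2 * d)) := by positivity
  have hge : 0 ≤ 1 / ε := by positivity
  by_cases h : r ≤ 0
  · have : lam d a r / (1 - r ^ 2) ≤ 1 / ε := by
      rw [div_le_div_iff₀ hpos e0]
      nlinarith
    linarith
  push Not at h
  suffices lam d a r / (1 - r ^ 2) ≤ 2 / (1 - r + 1 / (2 * d)) by linarith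
  have hcd : 1 / (2 * (d : ℝ)) * d = 1 / 2 := by field_simp
  rw [div_le_div_iff₀ hpos (by positivity)]
  by_cases h' : (1 - r) ≤ 1 / (2 * d)
  · have h3 : d * (1 - r) ≤ 1 / 2 := by nlinarith
    have hn := lam_le_near d a ha r h.le r1 (by linarith)
    have : lam d a r * (1 - r + 1 / (2 * d)) ≤ 2 * d * (1 - r) * (1 - r + 1 / (2 * d)) := by
      gcongr
    have e : 2 * d * (1 - r) * (1 - r + 1 / (2 * d)) = (1 - r) * (2 * (d * (1 - r)) + 1) := by
      field_simp
    nlinarith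
  · push Not at h'
    have : lam d a r * (1 - r + 1 / (2 * d)) ≤ 1 * (1 - r + 1 / (2 * d)) := by gcongr
    nlinarith

/-- **The integral bound (3.10):** for every `ε ∈ (0,1)`,
`∫_{−1+ε}^1 λ(r)/(1−r²) dr ≤ (10/ε) log d`. -/
theorem stmt16 (d : ℕ) (hd : 2 ≤ d) (a : ℕ → ℝ)
    (ha : ∃ p ∈ Finset.Icc 2 d, a p ≠ 0)
    (ε : ℝ) (hε : ε ∈ Set.Ioo (0 : ℝ) 1) :
    ∫ r in Set.Ioo (-1 + ε) 1, lam d a r / (1 - r ^ 2)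
      ≤ 10 / ε * Real.log d := by
  have hp := point_bound d hd a ha ε hε
  obtain ⟨e0, e1⟩ := hε
  have hd' : (2 : ℝ) ≤ d := by exact_mod_cast hd
  have hlog2 := Real.log_two_gt_d9
  have hlogd : Real.log 2 ≤ Real.log d := Real.log_le_log (by norm_num) hd'
  have hc : (0 : ℝ) < 1 / (2 * d) := by positivity
  by_cases hi : MeasureTheory.IntegrableOn (fun r => lam d a r / (1 - r ^ 2))
      (Set.Ioo (-1 + ε) 1) MeasureTheory.volume
  swap
  · rw [MeasureTheory.integral_undef hi]
    exact mul_nonneg (by positivity) (by linarith)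
  have hcont : ContinuousOn (fun r : ℝ => 1 / ε + 2 / (1 - r + 1 / (2 * d)))
      (Set.Icc (-1 + ε) 1) := by
    apply ContinuousOn.add continuousOn_const
    apply ContinuousOn.div continuousOn_const (by fun_prop)
    intro x hx
    have := hx.2
    exact ne_of_gt (by linarith)
  have hgi := (hcont.integrableOn_Icc (μ := MeasureTheory.volume)).mono_set
    Set.Ioo_subset_Icc_self
  refine (MeasureTheory.setIntegral_mono_on hi hgi measurableSet_Ioo hp).trans ?_
  rw [← MeasureTheory.integral_Ioc_eq_integral_Ioo,
    ← intervalIntegral.integral_of_le (by linarith)]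
  have hF : ∫ r in (-1 + ε)..1, (1 / ε + 2 / (1 - r + 1 / (2 * d))) =
      (1 / ε * 1 - 2 * Real.log (1 - 1 + 1 / (2 * d))) -
      (1 / ε * (-1 + ε) - 2 * Real.log (1 - (-1 + ε) + 1 / (2 * d))) := by
    apply intervalIntegral.integral_eq_sub_of_hasDerivAt
      (f := fun r => 1 / ε * r - 2 * Real.log (1 - r + 1 / (2 * d)))
    · intro x hx
      rw [Set.uIcc_of_le (by linarith)] at hx
      have hx2 := hx.2
      have hne : 1 - x + 1 / (2 * d) ≠ 0 := ne_of_gt (by linarith)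
      have h1 : HasDerivAt (fun r : ℝ => 1 - r + 1 / (2 * (d : ℝ))) (-1) x :=
        ((hasDerivAt_id x).const_sub 1).add_const _
      have h2 := ((hasDerivAt_id x).const_mul (1 / ε)).sub ((h1.log hne).const_mul 2)
      have h3 : 1 / ε + 2 / (1 - x + 1 / (2 * (d : ℝ))) =
          1 / ε * 1 - 2 * (-1 / (1 - x + 1 / (2 * (d : ℝ)))) := by ring
      rw [h3]
      exact h2
    · apply ContinuousOn.intervalIntegrable
      rwa [Set.uIcc_of_le (by linarith)]
  rw [hF]
  have hl1 : Real.log (1 - 1 + 1 / (2 * d)) = -(Real.log 2 + Real.log d) := by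
    rw [sub_self, zero_add, one_div, Real.log_inv, Real.log_mul (by norm_num) (by linarith)]
  have hc4 : 1 / (2 * (d : ℝ)) ≤ 1 / 4 := by
    apply one_div_le_one_div_of_le <;> linarith
  have hl2 : 2 * Real.log (1 - (-1 + ε) + 1 / (2 * d)) ≤ 3 * Real.log 2 := by
    have : 2 * Real.log (1 - (-1 + ε) + 1 / (2 * d)) ≤ 2 * Real.log (9 / 4) := by
      gcongr
      · linarith
      · linarith
    have h3 : 2 * Real.log (9 / 4) ≤ 3 * Real.log 2 := by
      have e1 : 2 * Real.log (9 / 4) = Real.log ((9 / 4) ^ 2) := by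
        rw [Real.log_pow]; norm_num
      have e2 : 3 * Real.log 2 = Real.log (2 ^ 3) := by
        rw [Real.log_pow]; norm_num
      rw [e1, e2]
      apply Real.log_le_log <;> norm_num
    linarith
  rw [hl1]
  have hinv : 1 ≤ 1 / ε := by rw [le_div_iff₀ e0]; linarith
  have he : 1 / ε * ε = 1 := by field_simp
  have h10 : 10 / ε * Real.log d = 10 * (1 / ε * Real.log d) := by ring
  rw [h10]
  have k1 : Real.log d ≤ 1 / ε * Real.log d := by nlinarith
  have k2 : 1 / ε * (0.6931) ≤ 1 / ε * Real.log d := by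
    apply mul_le_mul_of_nonneg_left _ (by linarith)
    linarith
  nlinarith

end
end

section
/- Let 1 ≤ K ≤ N and let M be a random K×N matrix whose entries are i.i.d. standard Gaussian N(0,1) variables (i.e. the coordinate functions on ℝ^{K×N} equipped with the product of standard Gaussian measures). Then E[√(det(M·Mᵀ))] = ∏_{k=0}^{K−1} √2·Γ((N−k+1)/2)/Γ((N−k)/2). -/
open MeasureTheory ProbabilityTheory Matrix

noncomputable section

section helpers
variable {E : Type*} [NormedAddCommGroup E] [InnerProductSpace ℝ E] [FiniteDimensional ℝ E]
  [MeasurableSpace E] [BorelSpace E]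

lemma aux_integrable_exp : Integrable (fun x : E => Real.exp (-(1/2) * ‖x‖ ^ 2)) := by
  by_contra h
  have h1 := GaussianFourier.integral_rexp_neg_mul_sq_norm (V := E) (b := 1/2) (by norm_num)
  rw [integral_undef h] at h1
  have : (0:ℝ) < (Real.pi / (1/2)) ^ (Module.finrank ℝ E / 2 : ℝ) := by positivity
  linarith

def auxZ (E : Type*) [NormedAddCommGroup E] [InnerProductSpace ℝ E] : ℝ :=
  (Real.pi / (1/2)) ^ (Module.finrank ℝ E / 2 : ℝ)

lemma auxZ_pos : 0 < auxZ E := by unfold auxZ; positivity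

lemma aux_density : stdGaussian E =
    (volume : Measure E).withDensity
      (fun x => ENNReal.ofReal ((auxZ E)⁻¹ * Real.exp (-(1/2) * ‖x‖ ^ 2))) := by
  have hfin : IsFiniteMeasure ((volume : Measure E).withDensity
      (fun x => ENNReal.ofReal ((auxZ E)⁻¹ * Real.exp (-(1/2) * ‖x‖ ^ 2)))) :=
    isFiniteMeasure_withDensity_ofReal (aux_integrable_exp.const_mul _).2
  apply Measure.ext_of_charFun
  ext t
  have hZ := auxZ_pos (E := E)
  rw [charFun_stdGaussian, charFun_apply, integral_withDensity_eq_integral_toReal_smul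
    (by fun_prop) (by simp)]
  have h := GaussianFourier.integral_cexp_neg_mul_sq_norm_add (V := E) (b := 1/2) (by norm_num)
    Complex.I t
  have h2 : ∀ x : E, (ENNReal.ofReal ((auxZ E)⁻¹ * Real.exp (-(1/2) * ‖x‖ ^ 2))).toReal •
      Complex.exp ((inner ℝ x t : ℝ) * Complex.I) =
      ((auxZ E)⁻¹ : ℂ) * Complex.exp (-(1/2) * ‖x‖ ^ 2 + Complex.I * (inner ℝ t x : ℝ)) := by
    intro x
    rw [ENNReal.toReal_ofReal (by positivity), Complex.exp_add, real_inner_comm]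
    simp
    rw [mul_comm Complex.I]
    ring
  simp_rw [h2]
  rw [integral_const_mul, h]
  have h3 : ((Real.pi : ℂ) / (1/2)) ^ (Module.finrank ℝ E / 2 : ℂ) = (auxZ E : ℂ) := by
    unfold auxZ
    rw [Complex.ofReal_cpow (by positivity)]
    simp
  rw [h3, ← mul_assoc, inv_mul_cancel₀ (by exact_mod_cast hZ.ne'), one_mul]
  congr 1
  simp
  ring

def auxC (d : ℝ) : ℝ := Real.sqrt 2 * Real.Gamma ((d + 1) / 2) / Real.Gamma (d / 2)

lemma aux_norm (hd : 0 < Module.finrank ℝ E) :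
    ∫ x, ‖x‖ ∂(stdGaussian E) = auxC (Module.finrank ℝ E) := by
  have : Nontrivial E := Module.finrank_pos_iff.mp hd
  have hZ := auxZ_pos (E := E)
  rw [aux_density, integral_withDensity_eq_integral_toReal_smul (by fun_prop) (by simp)]
  have h2 : ∀ x : E, (ENNReal.ofReal ((auxZ E)⁻¹ * Real.exp (-(1/2) * ‖x‖ ^ 2))).toReal • ‖x‖ =
      (auxZ E)⁻¹ * (‖x‖ * Real.exp (-(1/2) * ‖x‖ ^ 2)) := by
    intro x
    rw [ENNReal.toReal_ofReal (by positivity), smul_eq_mul]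
    ring
  simp_rw [h2]
  rw [integral_const_mul]
  have h1 : ∫ v : E, Real.exp (-(1/2) * ‖v‖ ^ 2) = auxZ E :=
    GaussianFourier.integral_rexp_neg_mul_sq_norm (V := E) (b := 1/2) (by norm_num)
  rw [integral_fun_norm_addHaar (volume : Measure E)
    (fun r => Real.exp (-(1/2) * r ^ 2))] at h1
  rw [integral_fun_norm_addHaar (volume : Measure E)
    (fun r => r * Real.exp (-(1/2) * r ^ 2))]
  set d := Module.finrank ℝ E with hdd
  have e1 : ∫ y in Set.Ioi (0:ℝ), y ^ (d - 1) • Real.exp (-(1/2) * y ^ 2) =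
      (1/2:ℝ) ^ (-(d:ℝ)/2) * (1/2) * Real.Gamma (d/2) := by
    have := integral_rpow_mul_exp_neg_mul_rpow (p := 2) (q := (d:ℝ) - 1) (b := 1/2) (by norm_num)
      (by have : (0:ℝ) < d := by exact_mod_cast hd
          linarith) (by norm_num)
    simp only [sub_add_cancel] at this
    rw [← this]
    refine setIntegral_congr_fun measurableSet_Ioi fun y hy => ?_
    simp only [smul_eq_mul]
    rw [← Real.rpow_natCast y (d-1), Nat.cast_sub hd]
    norm_num
  have e2 : ∫ y in Set.Ioi (0:ℝ), y ^ (d - 1) • (y * Real.exp (-(1/2) * y ^ 2)) =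
      (1/2:ℝ) ^ (-((d:ℝ)+1)/2) * (1/2) * Real.Gamma ((d+1)/2) := by
    have := integral_rpow_mul_exp_neg_mul_rpow (p := 2) (q := (d:ℝ)) (b := 1/2) (by norm_num)
      (by have : (0:ℝ) < d := by exact_mod_cast hd
          linarith) (by norm_num)
    rw [← this]
    refine setIntegral_congr_fun measurableSet_Ioi fun y hy => ?_
    simp only [smul_eq_mul]
    rw [← mul_assoc, ← pow_succ, Nat.sub_add_cancel hd]
    norm_num
  rw [e1] at h1
  rw [e2]
  simp only [nsmul_eq_mul, smul_eq_mul] at h1 ⊢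
  have hG : 0 < Real.Gamma ((d:ℝ)/2) := Real.Gamma_pos_of_pos (by positivity)
  have h3 : (1/2:ℝ) ^ (-((d:ℝ)+1)/2) = (1/2:ℝ) ^ (-(d:ℝ)/2) * Real.sqrt 2 := by
    rw [show -((d:ℝ)+1)/2 = -(d:ℝ)/2 + (-(1/2)) by ring, Real.rpow_add (by norm_num)]
    congr 1
    rw [Real.sqrt_eq_rpow, Real.rpow_neg (by norm_num), ← Real.inv_rpow (by norm_num)]
    norm_num
  rw [h3, auxC, inv_mul_eq_div, div_eq_div_iff hZ.ne' hG.ne', ← h1]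
  ring

lemma aux_proj (U : Submodule ℝ E) :
    (stdGaussian E).map U.orthogonalProjectionOnto = stdGaussian U := by
  have : IsFiniteMeasure ((stdGaussian E).map U.orthogonalProjectionOnto) := inferInstance
  apply Measure.ext_of_charFun
  ext t
  have h := charFun_stdGaussian (E := E) (t : E)
  rw [charFun_apply] at h
  rw [charFun_stdGaussian, charFun_apply, integral_map (by fun_prop)
    (Measurable.aestronglyMeasurable (by fun_prop))]
  simp_rw [Submodule.inner_orthogonalProjectionOnto_eq_of_mem_right]
  exact h

lemma aux_proj_norm (U : Submodule ℝ E) (hd : 0 < Module.finrank ℝ U) :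
    ∫⁻ x, ENNReal.ofReal ‖U.orthogonalProjectionOnto x‖ ∂(stdGaussian E) =
      ENNReal.ofReal (auxC (Module.finrank ℝ U)) := by
  rw [← aux_norm hd, ofReal_integral_eq_lintegral_ofReal, ← aux_proj U, lintegral_map]
  · fun_prop
  · fun_prop
  · exact IsGaussian.integrable_id.norm
  · exact ae_of_all _ fun _ => norm_nonneg _

lemma aux_gram {K : ℕ} (v : Fin K → E) (x : E) :
    (gram ℝ (Fin.cons x v : Fin (K+1) → E)).det =
      ‖(Submodule.span ℝ (Set.range v))ᗮ.orthogonalProjectionOnto x‖ ^ 2 * (gram ℝ v).det := by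
  set U := Submodule.span ℝ (Set.range v) with hU
  set p : E := (Uᗮ.orthogonalProjectionOnto x : E) with hp
  have hx : x - p ∈ U := by
    have := Submodule.sub_starProjection_mem_orthogonal (K := Uᗮ) x
    rw [Submodule.orthogonal_orthogonal] at this
    exact this
  have hpU : p ∈ Uᗮ := Submodule.coe_mem _
  obtain ⟨c, hc⟩ := (Submodule.mem_span_range_iff_exists_fun ℝ).1 hx
  have hpx : inner ℝ p x = ‖p‖ ^ 2 := by
    have h0 : inner ℝ (x - p) p = 0 := hpU _ hx
    rw [inner_sub_left, real_inner_self_eq_norm_sq] at h0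
    rw [real_inner_comm]; linarith
  have hpv : ∀ j, inner ℝ p (v j) = 0 := fun j => by
    rw [real_inner_comm]
    exact hpU _ (Submodule.subset_span ⟨j, rfl⟩)
  set G := gram ℝ (Fin.cons x v : Fin (K+1) → E) with hG
  have hrow : G 0 = (∑ k, (Fin.cons 0 c : Fin (K+1) → ℝ) k • G k) +
      (Fin.cons (‖p‖^2) 0 : Fin (K+1) → ℝ) := by
    have hxx : x = ∑ i, c i • v i + p := by rw [hc]; abel
    ext j
    rw [Fin.sum_univ_succ]
    simp only [Fin.cons_zero, Fin.cons_succ, zero_smul, zero_add, Pi.add_apply, Finset.sum_apply,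
      Pi.smul_apply, smul_eq_mul, hG, gram_apply]
    conv_lhs => rw [show (inner ℝ x ((Fin.cons x v : Fin (K+1) → E) j)) =
      inner ℝ (∑ i, c i • v i + p) ((Fin.cons x v : Fin (K+1) → E) j) by rw [← hxx]]
    rw [inner_add_left, sum_inner]
    simp_rw [real_inner_smul_left]
    congr 1
    refine Fin.cases ?_ (fun j => ?_) j
    · simpa using hpx
    · simpa using hpv j
  have hdet : G.det = (G.updateRow 0 (Fin.cons (‖p‖^2) 0 : Fin (K+1) → ℝ)).det := by
    conv_lhs => rw [← updateRow_eq_self G 0, hrow, det_updateRow_add, det_updateRow_sum]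
    simp
  rw [hdet, det_succ_row_zero, Fin.sum_univ_succ]
  simp only [updateRow_self, Fin.cons_zero, Fin.cons_succ]
  have : (G.updateRow 0 (Fin.cons (‖p‖^2) 0 : Fin (K+1) → ℝ)).submatrix Fin.succ
      (Fin.succAbove 0) = gram ℝ v := by
    ext i j
    simp [hG, updateRow_apply, Fin.succ_ne_zero]
  rw [this]
  simp [hp]

lemma aux_cont {K : ℕ} : Continuous (fun v : Fin K → E => (gram ℝ v).det) := by
  apply Continuous.matrix_det
  refine continuous_matrix fun i j => ?_
  simp only [gram_apply]
  fun_prop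

lemma aux_main (K : ℕ) (hK : K ≤ Module.finrank ℝ E) :
    ∫⁻ v : Fin K → E, ENNReal.ofReal (Real.sqrt (gram ℝ v).det)
      ∂(Measure.pi fun _ => stdGaussian E) =
    ∏ k ∈ Finset.range K, ENNReal.ofReal (auxC ((Module.finrank ℝ E : ℝ) - k)) := by
  induction K with
  | zero => simp
  | succ K ih =>
    have hm : ∀ n, Measurable fun v : Fin n → E => ENNReal.ofReal (Real.sqrt (gram ℝ v).det) :=
      fun n => (ENNReal.continuous_ofReal.comp (Real.continuous_sqrt.comp aux_cont)).measurable
    have hmp := (measurePreserving_piFinSuccAbove (fun _ : Fin (K+1) => stdGaussian E) 0).symm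
    have hm2 := ((hm (K+1)).comp hmp.measurable).aemeasurable
      (μ := (stdGaussian E).prod (Measure.pi fun _ : Fin K => stdGaussian E))
    have hF := lintegral_prod_symm _ hm2
    simp only [Function.comp_def] at hF
    rw [← hmp.lintegral_comp (hm _), hF, Finset.prod_range_succ,
      ← ih (by omega), ← lintegral_mul_const _ (hm _)]
    refine lintegral_congr fun v => ?_
    have key : ∀ x : E, ENNReal.ofReal (Real.sqrt (gram ℝ
        ((MeasurableEquiv.piFinSuccAbove (fun _ : Fin (K+1) => E) 0).symm (x, v))).det) =
        ENNReal.ofReal (Real.sqrt (gram ℝ v).det) * ENNReal.ofReal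
        ‖(Submodule.span ℝ (Set.range v))ᗮ.orthogonalProjectionOnto x‖ := by
      intro x
      have : (MeasurableEquiv.piFinSuccAbove (fun _ : Fin (K+1) => E) 0).symm (x, v) =
        (Fin.cons x v : Fin (K+1) → E) := by
        simp [MeasurableEquiv.piFinSuccAbove]
        rfl
      rw [this, aux_gram, Real.sqrt_mul (by positivity), Real.sqrt_sq (norm_nonneg _), mul_comm,
        ENNReal.ofReal_mul (Real.sqrt_nonneg _)]
    simp_rw [key]
    rw [lintegral_const_mul _ (by fun_prop)]
    by_cases h : (gram ℝ v).det = 0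
    · simp [h]
    · have hli := det_gram_ne_zero_iff_linearIndependent.1 h
      have hr := finrank_span_eq_card hli
      have hs := Submodule.finrank_add_finrank_orthogonal (Submodule.span ℝ (Set.range v))
      rw [hr, Fintype.card_fin] at hs
      rw [aux_proj_norm _ (by omega)]
      congr 3
      rw [← hs]; push_cast; ring

end helpers

/-- **Expected generalized Jacobian of a Gaussian matrix (Eq. (4.7)):**
for `1 ≤ K ≤ N` and `M` a `K × N` matrix with i.i.d. `N(0,1)` entries,
`E[√(det(M Mᵀ))] = ∏_{k=0}^{K−1} √2 Γ((N−k+1)/2)/Γ((N−k)/2)`. -/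
theorem stmt17 (N K : ℕ) (hK : 1 ≤ K) (hKN : K ≤ N) :
    ∫ M : Fin K → Fin N → ℝ, Real.sqrt (Matrix.of M * (Matrix.of M)ᵀ).det
        ∂(Measure.pi fun _ : Fin K => Measure.pi fun _ : Fin N => gaussianReal 0 1)
      = ∏ k ∈ Finset.range K,
          Real.sqrt 2 * Real.Gamma (((N : ℝ) - k + 1) / 2) / Real.Gamma (((N : ℝ) - k) / 2) := by
  have hg : ∀ M : Fin K → Fin N → ℝ, (Matrix.of M * (Matrix.of M)ᵀ) =
      gram ℝ (fun i => WithLp.toLp 2 (M i) : Fin K → EuclideanSpace ℝ (Fin N)) := by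
    intro M
    ext i j
    simp [mul_apply, PiLp.inner_apply, mul_comm]
  have hm : Measurable fun v : Fin K → EuclideanSpace ℝ (Fin N) => Real.sqrt (gram ℝ v).det :=
    (Real.continuous_sqrt.comp aux_cont).measurable
  have hmp := measurePreserving_pi
    (fun _ : Fin K => Measure.pi fun _ : Fin N => gaussianReal 0 1)
    (fun _ : Fin K => stdGaussian (EuclideanSpace ℝ (Fin N)))
    (f := fun _ => WithLp.toLp 2)
    (fun _ => ⟨by fun_prop, map_pi_eq_stdGaussian⟩)
  simp_rw [hg]
  have hm2 := hm.comp hmp.measurable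
  rw [integral_eq_lintegral_of_nonneg_ae (ae_of_all _ fun _ => Real.sqrt_nonneg _)
    hm2.aestronglyMeasurable]
  have h1 := hmp.lintegral_comp hm.ennreal_ofReal
  rw [h1, aux_main K (by simpa using hKN), ENNReal.toReal_prod]
  refine Finset.prod_congr rfl fun k hk => ?_
  have hkN : (k:ℝ) < N := by
    have := Finset.mem_range.1 hk
    exact_mod_cast (by omega : k < N)
  rw [ENNReal.toReal_ofReal]
  · simp [auxC]
  · have h1 : 0 < Real.Gamma (((N : ℝ) - k + 1) / 2) := Real.Gamma_pos_of_pos (by linarith)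
    have h2 : 0 < Real.Gamma (((N : ℝ) - k) / 2) := Real.Gamma_pos_of_pos (by linarith)
    simp only [auxC, finrank_euclideanSpace, Fintype.card_fin]
    positivity

end
end

section
/- Let 1 ≤ K ≤ N and let M be a random K×N matrix whose entries are i.i.d. standard Gaussian N(0,1) variables (i.e. the coordinate functions on ℝ^{K×N} equipped with the product of standard Gaussian measures). Then E[det(M·Mᵀ)] = N!/(N−K)!. -/
open MeasureTheory ProbabilityTheory Matrix

noncomputable section

lemma aux_eq {N : ℕ} (a b : Fin N) (x : Fin N → ℝ) :
    x a * x b = ∏ j, ((if j = a then x j else 1) * (if j = b then x j else 1)) := by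
  rw [Finset.prod_mul_distrib]; simp

lemma gauss_int1 : Integrable (fun x : ℝ => x) (gaussianReal 0 1) :=
  (memLp_id_gaussianReal (μ := 0) (v := 1) 1).integrable (by simp)

lemma gauss_int2 : Integrable (fun x : ℝ => x * x) (gaussianReal 0 1) := by
  have := (memLp_id_gaussianReal (μ := 0) (v := 1) 2).integrable_sq
  simpa [pow_two] using this

lemma gauss_sq : ∫ x : ℝ, x * x ∂(gaussianReal 0 1) = 1 := by
  have h := variance_fun_id_gaussianReal (μ := 0) (v := 1)
  rw [variance_eq_integral (by fun_prop)] at h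
  simpa [integral_id_gaussianReal, pow_two] using h

lemma row_int {N : ℕ} (a b : Fin N) :
    Integrable (fun x : Fin N → ℝ => x a * x b) (Measure.pi fun _ => gaussianReal 0 1) := by
  simp_rw [aux_eq a b]
  apply Integrable.fintype_prod (f := fun j (y : ℝ) =>
    ((if j = a then y else 1) * (if j = b then y else 1)))
  intro j
  by_cases h1 : j = a <;> by_cases h2 : j = b <;>
    simp only [h1, h2, if_true, if_false, mul_one, one_mul]
  all_goals first
    | (split_ifs <;> first | exact gauss_int2 | (simp; exact gauss_int1) | simp [gauss_int1])
    | exact gauss_int2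
    | exact gauss_int1
    | exact integrable_const _

lemma row_exp {N : ℕ} (a b : Fin N) :
    ∫ x : Fin N → ℝ, x a * x b ∂(Measure.pi fun _ => gaussianReal 0 1)
      = if a = b then 1 else 0 := by
  simp_rw [aux_eq a b]
  rw [integral_fintype_prod_eq_prod (f := fun j (y : ℝ) =>
    ((if j = a then y else 1) * (if j = b then y else 1)))]
  split_ifs with h
  · subst h
    apply Finset.prod_eq_one
    intro j _
    by_cases h1 : j = a
    · simp [h1, gauss_sq]
    · simp [h1]
  · apply Finset.prod_eq_zero (Finset.mem_univ a)
    simp [h, integral_id_gaussianReal]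

lemma det_expand {N K : ℕ} (M : Fin K → Fin N → ℝ) :
    (Matrix.of M * (Matrix.of M)ᵀ).det =
      ∑ f : Fin K → Fin N, ∑ σ : Equiv.Perm (Fin K),
        ((Equiv.Perm.sign σ : ℤ) : ℝ) * ∏ i, (M i (f (σ⁻¹ i)) * M i (f i)) := by
  rw [Matrix.det_apply', Finset.sum_comm]
  refine Finset.sum_congr rfl fun σ _ => ?_
  rw [← Finset.mul_sum]
  congr 1
  simp only [Matrix.mul_apply, Matrix.of_apply, Matrix.transpose_apply]
  rw [Finset.prod_univ_sum, Fintype.piFinset_univ]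
  refine Finset.sum_congr rfl fun f _ => ?_
  rw [Finset.prod_mul_distrib, Finset.prod_mul_distrib]
  congr 1
  rw [← Equiv.prod_comp σ (fun i => M i (f (σ⁻¹ i)))]
  simp

lemma comb {N K : ℕ} (f : Fin K → Fin N) :
    ∑ σ : Equiv.Perm (Fin K), ((Equiv.Perm.sign σ : ℤ) : ℝ) *
      ∏ i, (if f (σ⁻¹ i) = f i then (1 : ℝ) else 0) =
    if Function.Injective f then 1 else 0 := by
  have h : ∑ σ : Equiv.Perm (Fin K), ((Equiv.Perm.sign σ : ℤ) : ℝ) *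
      ∏ i, (if f (σ⁻¹ i) = f i then (1 : ℝ) else 0) =
      (Matrix.of fun i j : Fin K => if f i = f j then (1 : ℝ) else 0).det := by
    rw [Matrix.det_apply', ← Equiv.sum_comp (Equiv.inv (Equiv.Perm (Fin K)))]
    simp
  rw [h]
  split_ifs with hf
  · convert Matrix.det_one (n := Fin K) (R := ℝ)
    ext i j
    simp [Matrix.one_apply, hf.eq_iff]
  · simp only [Function.Injective, not_forall] at hf
    obtain ⟨a, b, hab, hne⟩ := hf
    apply Matrix.det_zero_of_row_eq hne
    ext j
    simp [hab]

/-- **Expected squared generalized Jacobian of a Gaussian matrix:**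
for `1 ≤ K ≤ N` and `M` a `K × N` matrix with i.i.d. `N(0,1)` entries,
`E[det(M Mᵀ)] = N!/(N−K)!`. -/
theorem stmt18 (N K : ℕ) (hK : 1 ≤ K) (hKN : K ≤ N) :
    ∫ M : Fin K → Fin N → ℝ, (Matrix.of M * (Matrix.of M)ᵀ).det
        ∂(Measure.pi fun _ : Fin K => Measure.pi fun _ : Fin N => gaussianReal 0 1)
      = (N.factorial : ℝ) / ((N - K).factorial : ℝ) := by
  have hint : ∀ (f : Fin K → Fin N) (σ : Equiv.Perm (Fin K)),
      Integrable (fun M : Fin K → Fin N → ℝ =>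
        ((Equiv.Perm.sign σ : ℤ) : ℝ) * ∏ i, (M i (f (σ⁻¹ i)) * M i (f i)))
        (Measure.pi fun _ : Fin K => Measure.pi fun _ : Fin N => gaussianReal 0 1) := by
    intro f σ
    apply Integrable.const_mul
    exact Integrable.fintype_prod (f := fun i (x : Fin N → ℝ) => x (f (σ⁻¹ i)) * x (f i))
      (fun i => row_int _ _)
  simp_rw [det_expand]
  rw [integral_finsetSum _ (fun f _ => integrable_finsetSum _ fun σ _ => hint f σ)]
  have key : ∀ f : Fin K → Fin N,
      ∫ M : Fin K → Fin N → ℝ, ∑ σ : Equiv.Perm (Fin K),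
        ((Equiv.Perm.sign σ : ℤ) : ℝ) * ∏ i, (M i (f (σ⁻¹ i)) * M i (f i))
        ∂(Measure.pi fun _ : Fin K => Measure.pi fun _ : Fin N => gaussianReal 0 1)
      = if Function.Injective f then 1 else 0 := by
    intro f
    rw [integral_finsetSum _ (fun σ _ => hint f σ), ← comb f]
    refine Finset.sum_congr rfl fun σ _ => ?_
    rw [integral_const_mul]
    congr 1
    rw [integral_fintype_prod_eq_prod
      (f := fun i (x : Fin N → ℝ) => x (f (σ⁻¹ i)) * x (f i))]
    exact Finset.prod_congr rfl fun i _ => row_exp _ _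
  rw [Finset.sum_congr rfl fun f _ => key f]
  rw [Finset.sum_boole]
  have hc : (Finset.univ.filter fun f : Fin K → Fin N => Function.Injective f).card
      = N.descFactorial K := by
    rw [← Fintype.card_subtype,
      Fintype.card_congr (Equiv.subtypeInjectiveEquivEmbedding (Fin K) (Fin N)),
      Fintype.card_embedding_eq]
    simp
  rw [hc, eq_div_iff (by positivity), ← Nat.factorial_mul_descFactorial hKN]
  push_cast
  ring

end
end
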